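/- arXiv:1312.4192 — 2 statements merged into one kernel-verified Lean document; each statement's English description precedes it below -/
import Mathlib

section
/- Let e_1,e_2,e_3,e_4 denote the elementary symmetric polynomials in x_1,x_2,x_3,x_4 over ℚ, set y_i = x_i + x_i^2/2 + x_i^3/6 + x_i^4/24 for i=1,...,4, and let Td_4 = 1 + e_1/2 + (e_1^2+e_2)/12 + e_1e_2/24 + (−e_1^4 + 4e_1^2e_2 + 3e_2^2 + e_1e_3 − e_4)/720. Let σ_k(y) denote the k-th elementary symmetric polynomial evaluated at y_1,...,y_4. Then the homogeneous component of degree 4 of (σ_1(y)σ_2(y) − 3σ_3(y))·Td_4 equals (1/2)(3e_1^2e_2 − 2e_2^2 − 9e_1e_3 + 12e_4). -/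
open MvPolynomial

theorem Multiset.esymm_quadruple {R : Type*} [CommSemiring R] (a b c d : R) :
    ({a, b, c, d} : Multiset R).esymm 1 = a + b + c + d ∧
    ({a, b, c, d} : Multiset R).esymm 2 = a * b + a * c + a * d + b * c + b * d + c * d ∧
    ({a, b, c, d} : Multiset R).esymm 3 = a * b * c + a * b * d + a * c * d + b * c * d ∧
    ({a, b, c, d} : Multiset R).esymm 4 = a * b * c * d := by
  simp only [Multiset.esymm, Multiset.insert_eq_cons, ← Multiset.cons_zero,
    Multiset.powersetCard_cons, Multiset.powersetCard_zero_right,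
    Multiset.powersetCard_zero_left, Multiset.map_cons, Multiset.map_add, Multiset.map_zero,
    Multiset.sum_add, Multiset.sum_cons, Multiset.sum_zero, Multiset.prod_cons,
    Multiset.prod_zero]
  refine ⟨by ring, ?_, ?_, ?_⟩ <;> simp <;> ring

theorem MvPolynomial.esymm_fin_four (R : Type*) [CommSemiring R] (k : ℕ) :
    esymm (Fin 4) R k = ({X 0, X 1, X 2, X 3} : Multiset (MvPolynomial (Fin 4) R)).esymm k := by
  rw [esymm_eq_multiset_esymm]
  rfl

theorem MvPolynomial.homogeneousComponent_eq_zero_of_mem_pow_idealOfVars {σ R : Type*}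
    [CommRing R] {m n : ℕ} (h : m < n) {p : MvPolynomial σ R}
    (hp : p ∈ idealOfVars σ R ^ n) : homogeneousComponent m p = 0 := by
  refine homogeneousComponent_eq_zero' _ _ fun d hd hdm => ?_
  exact mem_support_iff.mp hd ((mem_pow_idealOfVars_iff' n p).mp hp d (hdm ▸ h))

theorem MvPolynomial.IsHomogeneous.mem_pow_idealOfVars {σ R : Type*} [CommRing R] {n : ℕ}
    {p : MvPolynomial σ R} (hp : p.IsHomogeneous n) : p ∈ idealOfVars σ R ^ n :=
  (mem_pow_idealOfVars_iff' n p).mpr fun _ hd => hp.coeff_eq_zero hd.ne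

/-- The terms of degree at most four of `y_a ^ 2 * y_b`, where `y_x = x + h x² + s x³ + t x⁴`
and `2 h = 1`. -/
theorem Ideal.truncation_sq_mul_mem_pow_five {R : Type*} [CommRing R] {I : Ideal R}
    {a b h s t : R} (hh : 2 * h = 1) (ha : a ∈ I) (hb : b ∈ I) :
    (a + h * a ^ 2 + s * a ^ 3 + t * a ^ 4) ^ 2 * (b + h * b ^ 2 + s * b ^ 3 + t * b ^ 4)
      - (a ^ 2 * b + (a ^ 3 * b + h * (a ^ 2 * b ^ 2))) ∈ I ^ 5 := by
  have h41 : a ^ 4 * b ∈ I ^ 5 := by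
    simpa [← pow_succ] using Ideal.mul_mem_mul (Ideal.pow_mem_pow ha 4) hb
  have h32 : a ^ 3 * b ^ 2 ∈ I ^ 5 := by
    simpa [← pow_add] using Ideal.mul_mem_mul (Ideal.pow_mem_pow ha 3) (Ideal.pow_mem_pow hb 2)
  have h23 : a ^ 2 * b ^ 3 ∈ I ^ 5 := by
    simpa [← pow_add] using Ideal.mul_mem_mul (Ideal.pow_mem_pow ha 2) (Ideal.pow_mem_pow hb 3)
  have key := add_mem (add_mem
    (Ideal.mul_mem_left _ (((h + s * a + t * a ^ 2) ^ 2 + 2 * (s + t * a))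
      * (1 + h * b + s * b ^ 2 + t * b ^ 3)) h41)
    (Ideal.mul_mem_left _ h h32))
    (Ideal.mul_mem_left _ ((1 + a) * (s + t * b)) h23)
  convert key using 1
  linear_combination a ^ 3 * (b + h * b ^ 2 + s * b ^ 3 + t * b ^ 4) * hh

/-- κ_{1,2}[M] in dimension 4: the degree-4 part of (σ₁(y)σ₂(y) - 3σ₃(y))·Td₄ is (1/2)(3e₁²e₂ - 2e₂² - 9e₁e₃ + 12e₄). -/
theorem stmt_9 :
    let y : Fin 4 → MvPolynomial (Fin 4) ℚ := fun i =>
      X i + C (1/2 : ℚ) * X i ^ 2 + C (1/6 : ℚ) * X i ^ 3 + C (1/24 : ℚ) * X i ^ 4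
    let e : ℕ → MvPolynomial (Fin 4) ℚ := esymm (Fin 4) ℚ
    let Td₄ : MvPolynomial (Fin 4) ℚ :=
      1 + C (1/2 : ℚ) * e 1 + C (1/12 : ℚ) * (e 1 ^ 2 + e 2) + C (1/24 : ℚ) * (e 1 * e 2)
        + C (1/720 : ℚ) * (-e 1 ^ 4 + 4 * e 1 ^ 2 * e 2 + 3 * e 2 ^ 2 + e 1 * e 3 - e 4)
    let σ : ℕ → MvPolynomial (Fin 4) ℚ := fun k =>
      ({y 0, y 1, y 2, y 3} : Multiset (MvPolynomial (Fin 4) ℚ)).esymm k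
    (homogeneousComponent 4) ((σ 1 * σ 2 - 3 * σ 3) * Td₄)
      = C (1/2 : ℚ) * (3 * e 1 ^ 2 * e 2 - 2 * e 2 ^ 2 - 9 * (e 1 * e 3) + 12 * e 4) := by
  intro y e Td₄ σ
  have hX : ∀ i, (X i : MvPolynomial (Fin 4) ℚ) ∈ idealOfVars (Fin 4) ℚ := fun i =>
    Ideal.subset_span ⟨i, rfl⟩
  have hh : 2 * C (1/2 : ℚ) = (1 : MvPolynomial (Fin 4) ℚ) := by
    rw [show (2 : MvPolynomial (Fin 4) ℚ) = C 2 from rfl, ← C_mul]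
    norm_num
  obtain ⟨hσ1, hσ2, hσ3, -⟩ := Multiset.esymm_quadruple (y 0) (y 1) (y 2) (y 3)
  obtain ⟨he1, he2, he3, he4⟩ :=
    Multiset.esymm_quadruple (X 0 : MvPolynomial (Fin 4) ℚ) (X 1) (X 2) (X 3)
  simp only [← esymm_fin_four] at he1 he2 he3 he4
  have hom_e (k : ℕ) : (e k).IsHomogeneous k := by
    change (esymm (Fin 4) ℚ k).IsHomogeneous k
    refine IsHomogeneous.sum _ _ _ fun s hs => ?_
    simpa [(Finset.mem_powersetCard.mp hs).2] using
      IsHomogeneous.prod s X (fun _ => 1) fun i _ => isHomogeneous_X ℚ i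
  have hD : σ 1 * σ 2 - 3 * σ 3 = ∑ i, ∑ j, if i = j then 0 else y i ^ 2 * y j := by
    simp only [σ, hσ1, hσ2, hσ3]
    simp [Fin.sum_univ_four]
    ring
  set A : MvPolynomial (Fin 4) ℚ := e 1 * e 2 - 3 * e 3 with hA
  set B : MvPolynomial (Fin 4) ℚ := C (1/2 : ℚ) *
    (2 * e 1 ^ 2 * e 2 - 2 * e 2 ^ 2 - 6 * (e 1 * e 3) + 12 * e 4) with hB
  have hR : σ 1 * σ 2 - 3 * σ 3 - (A + B) ∈ idealOfVars (Fin 4) ℚ ^ 5 := by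
    have hAB : A + B = ∑ i : Fin 4, ∑ j : Fin 4, if i = j then 0 else
        (X i ^ 2 * X j + (X i ^ 3 * X j + C (1/2 : ℚ) * (X i ^ 2 * X j ^ 2))) := by
      simp only [hA, hB, e, he1, he2, he3, he4]
      simp only [Fin.sum_univ_four, Fin.reduceEq, if_true, if_false]
      generalize C (1/2 : ℚ) = h at hh
      generalize (X 0 : MvPolynomial (Fin 4) ℚ) = a
      generalize (X 1 : MvPolynomial (Fin 4) ℚ) = b
      generalize (X 2 : MvPolynomial (Fin 4) ℚ) = c
      generalize (X 3 : MvPolynomial (Fin 4) ℚ) = d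
      linear_combination (a ^ 3 * (b + c + d) + b ^ 3 * (a + c + d) + c ^ 3 * (a + b + d)
        + d ^ 3 * (a + b + c)) * hh
    rw [hD, hAB, ← Finset.sum_sub_distrib]
    refine sum_mem fun i _ => ?_
    rw [← Finset.sum_sub_distrib]
    refine sum_mem fun j _ => ?_
    split_ifs
    · simp
    · exact Ideal.truncation_sq_mul_mem_pow_five hh (hX i) (hX j)
  have homA : A.IsHomogeneous 3 :=
    ((hom_e 1).mul (hom_e 2)).sub ((hom_e 3).C_mul 3)
  have homB : B.IsHomogeneous 4 := by
    refine IsHomogeneous.C_mul (.add (.sub (.sub ?_ ?_) ?_) ?_) _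
    · exact (((hom_e 1).pow 2).C_mul 2).mul (hom_e 2)
    · exact ((hom_e 2).pow 2).C_mul 2
    · exact ((hom_e 1).mul (hom_e 3)).C_mul 6
    · exact (hom_e 4).C_mul 12
  have hT : Td₄ - (1 + C (1/2 : ℚ) * e 1) ∈ idealOfVars (Fin 4) ℚ ^ 2 := by
    have h1 : e 1 ^ 2 ∈ idealOfVars (Fin 4) ℚ ^ 2 := ((hom_e 1).pow 2).mem_pow_idealOfVars
    have h2 := (hom_e 2).mem_pow_idealOfVars
    have h3 := Ideal.pow_le_pow_right (show 2 ≤ 3 by norm_num) (hom_e 3).mem_pow_idealOfVars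
    have h4 := Ideal.pow_le_pow_right (show 2 ≤ 4 by norm_num) (hom_e 4).mem_pow_idealOfVars
    have key := add_mem (add_mem
      (Ideal.mul_mem_left _ (C (1/12 : ℚ) - C (1/720 : ℚ) * e 1 ^ 2) h1)
      (Ideal.mul_mem_left _ (C (1/12 : ℚ) + C (1/24 : ℚ) * e 1
        + C (1/720 : ℚ) * (4 * e 1 ^ 2 + 3 * e 2)) h2))
      (sub_mem (Ideal.mul_mem_left _ (C (1/720 : ℚ) * e 1) h3)
        (Ideal.mul_mem_left _ (C (1/720 : ℚ)) h4))
    convert key using 1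
    simp only [Td₄]
    ring
  have hBe : B * (Td₄ - 1) ∈ idealOfVars (Fin 4) ℚ ^ 5 := by
    have h1 : Td₄ - 1 ∈ idealOfVars (Fin 4) ℚ ^ 1 := by
      convert add_mem (Ideal.pow_le_pow_right (show 1 ≤ 2 by norm_num) hT)
        (Ideal.mul_mem_left _ (C (1/2 : ℚ)) (hom_e 1).mem_pow_idealOfVars) using 1
      ring
    simpa [← pow_succ] using Ideal.mul_mem_mul homB.mem_pow_idealOfVars h1
  have hAT : A * (Td₄ - (1 + C (1/2 : ℚ) * e 1)) ∈ idealOfVars (Fin 4) ℚ ^ 5 := by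
    simpa [← pow_add] using Ideal.mul_mem_mul homA.mem_pow_idealOfVars hT
  have hrest := add_mem (add_mem hBe hAT) (Ideal.mul_mem_right Td₄ _ hR)
  have hsplit : (σ 1 * σ 2 - 3 * σ 3) * Td₄ = A + (B + C (1/2 : ℚ) * (e 1 * A)) +
      (B * (Td₄ - 1) + A * (Td₄ - (1 + C (1/2 : ℚ) * e 1))
        + (σ 1 * σ 2 - 3 * σ 3 - (A + B)) * Td₄) := by ring
  have hom4 : (B + C (1/2 : ℚ) * (e 1 * A)).IsHomogeneous 4 :=
    homB.add (((hom_e 1).mul homA).C_mul _)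
  rw [hsplit, map_add, map_add,
    homogeneousComponent_eq_zero_of_mem_pow_idealOfVars (by norm_num) hrest,
    homogeneousComponent_of_mem homA, homogeneousComponent_of_mem hom4]
  simp only [hA, hB, if_true, Nat.reduceEqDiff, if_false]
  ring
end

section
/- Let e_1,e_2,e_3,e_4 denote the elementary symmetric polynomials in x_1,x_2,x_3,x_4 over ℚ, set y_i = x_i + x_i^2/2 + x_i^3/6 + x_i^4/24 for i=1,...,4, and let Td_4 = 1 + e_1/2 + (e_1^2+e_2)/12 + e_1e_2/24 + (−e_1^4 + 4e_1^2e_2 + 3e_2^2 + e_1e_3 − e_4)/720. Let σ_k(y) denote the k-th elementary symmetric polynomial evaluated at y_1,...,y_4. Then the homogeneous component of degree 4 of (σ_1(y)^3 − 3σ_1(y)σ_2(y) + 3σ_3(y))·Td_4 equals (1/2)(4e_1^4 − 15e_1^2e_2 + 6e_2^2 + 15e_1e_3 − 12e_4). -/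
open MvPolynomial

namespace Multiset

variable {R : Type*} [CommRing R] (a b c d : R)

theorem esymm_quadruple_one : ({a, b, c, d} : Multiset R).esymm 1 = a + b + c + d := by
  simp [esymm, powersetCard_one]
  ring

theorem esymm_quadruple_two :
    ({a, b, c, d} : Multiset R).esymm 2 = a * b + a * c + a * d + b * c + b * d + c * d := by
  simp [esymm, insert_eq_cons, ← cons_zero, powersetCard_cons, powersetCard_one]
  ring

theorem esymm_quadruple_three :
    ({a, b, c, d} : Multiset R).esymm 3 = a * b * c + a * b * d + a * c * d + b * c * d := by
  simp [esymm, insert_eq_cons, ← cons_zero, powersetCard_cons, powersetCard_one]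
  ring

theorem esymm_quadruple_four : ({a, b, c, d} : Multiset R).esymm 4 = a * b * c * d := by
  simp [esymm, insert_eq_cons, ← cons_zero, powersetCard_cons, powersetCard_one]
  ring

end Multiset

namespace MvPolynomial

variable {σ R : Type*} [CommSemiring R]

theorem IsHomogeneous.homogeneousComponent_mul {f : MvPolynomial σ R} {n : ℕ}
    (hf : f.IsHomogeneous n) (m : ℕ) (g : MvPolynomial σ R) :
    homogeneousComponent m (f * g) = if n ≤ m then f * homogeneousComponent (m - n) g else 0 := by
  let : GradedAlgebra (homogeneousSubmodule σ R) := gradedAlgebra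
  have h := DirectSum.coe_decompose_mul_of_left_mem (homogeneousSubmodule σ R) m (b := g) hf
  rwa [show (DirectSum.decompose (homogeneousSubmodule σ R) (f * g) m : MvPolynomial σ R) =
      homogeneousComponent m (f * g) from decomposition.decompose'_apply _ _,
    show (DirectSum.decompose (homogeneousSubmodule σ R) g (m - n) : MvPolynomial σ R) =
      homogeneousComponent (m - n) g from decomposition.decompose'_apply _ _] at h

theorem isHomogeneous_esymm [Fintype σ] (n : ℕ) : (esymm σ R n).IsHomogeneous n := by
  refine IsHomogeneous.sum _ _ _ fun t ht => ?_
  have h := IsHomogeneous.prod t (fun i => (X i : MvPolynomial σ R)) (fun _ => 1)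
    fun i _ => isHomogeneous_X R i
  simpa [(Finset.mem_powersetCard.mp ht).2] using h

theorem isHomogeneous_psum [Fintype σ] (n : ℕ) : (psum σ R n).IsHomogeneous n :=
  IsHomogeneous.sum _ _ _ fun i _ => isHomogeneous_X_pow i n

theorem esymm_fin_four_s10 (n : ℕ) :
    esymm (Fin 4) R n = ({X 0, X 1, X 2, X 3} : Multiset (MvPolynomial (Fin 4) R)).esymm n := by
  rw [esymm_eq_multiset_esymm]
  rfl

end MvPolynomial

/-- κ_{3}[M] in dimension 4: the degree-4 part of (σ₁(y)³ - 3σ₁(y)σ₂(y) + 3σ₃(y))·Td₄ is (1/2)(4e₁⁴ - 15e₁²e₂ + 6e₂² + 15e₁e₃ - 12e₄). -/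
theorem stmt_10 :
    let y : Fin 4 → MvPolynomial (Fin 4) ℚ := fun i =>
      X i + C (1/2 : ℚ) * X i ^ 2 + C (1/6 : ℚ) * X i ^ 3 + C (1/24 : ℚ) * X i ^ 4
    let e : ℕ → MvPolynomial (Fin 4) ℚ := esymm (Fin 4) ℚ
    let Td₄ : MvPolynomial (Fin 4) ℚ :=
      1 + C (1/2 : ℚ) * e 1 + C (1/12 : ℚ) * (e 1 ^ 2 + e 2) + C (1/24 : ℚ) * (e 1 * e 2)
        + C (1/720 : ℚ) * (-e 1 ^ 4 + 4 * e 1 ^ 2 * e 2 + 3 * e 2 ^ 2 + e 1 * e 3 - e 4)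
    let σ : ℕ → MvPolynomial (Fin 4) ℚ := fun k =>
      ({y 0, y 1, y 2, y 3} : Multiset (MvPolynomial (Fin 4) ℚ)).esymm k
    (homogeneousComponent 4) ((σ 1 ^ 3 - 3 * (σ 1 * σ 2) + 3 * σ 3) * Td₄)
      = C (1/2 : ℚ) * (4 * e 1 ^ 4 - 15 * e 1 ^ 2 * e 2 + 6 * e 2 ^ 2 + 15 * (e 1 * e 3) - 12 * e 4) := by
  intro y e Td₄ σ
  have he (k : ℕ) : (e k).IsHomogeneous k := isHomogeneous_esymm k
  let T₂ := C (1/12 : ℚ) * (e 1 ^ 2 + e 2)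
  let T₃ := C (1/24 : ℚ) * (e 1 * e 2)
  let T₄ := C (1/720 : ℚ) * (-e 1 ^ 4 + 4 * e 1 ^ 2 * e 2 + 3 * e 2 ^ 2 + e 1 * e 3 - e 4)
  have h_one : (1 : MvPolynomial (Fin 4) ℚ).IsHomogeneous 0 := isHomogeneous_one _ _
  have hT₁ : (C (1/2 : ℚ) * e 1).IsHomogeneous 1 := (he 1).C_mul _
  have hT₂ : T₂.IsHomogeneous 2 := (((he 1).pow 2).add (he 2)).C_mul _
  have hT₃ : T₃.IsHomogeneous 3 := ((he 1).mul (he 2)).C_mul _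
  have hT₄ : T₄.IsHomogeneous 4 := by
    refine IsHomogeneous.C_mul ?_ _
    have h (r : ℚ) : (C r * e 1 ^ 2 * e 2).IsHomogeneous 4 :=
      (((he 1).pow 2).C_mul r).mul (he 2)
    exact (((((he 1).pow 4).neg.add (h 4)).add (((he 2).pow 2).C_mul 3)).add
      ((he 1).mul (he 3))).sub (he 4)
  have hTd : Td₄ = 1 + C (1/2 : ℚ) * e 1 + T₂ + T₃ + T₄ := rfl
  have hTd_zero : homogeneousComponent 0 Td₄ = 1 := by
    simp only [hTd, map_add, homogeneousComponent_of_mem h_one, homogeneousComponent_of_mem hT₁,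
      homogeneousComponent_of_mem hT₂, homogeneousComponent_of_mem hT₃,
      homogeneousComponent_of_mem hT₄]
    simp
  have hTd_one : homogeneousComponent 1 Td₄ = C (1/2 : ℚ) * e 1 := by
    simp only [hTd, map_add, homogeneousComponent_of_mem h_one, homogeneousComponent_of_mem hT₁,
      homogeneousComponent_of_mem hT₂, homogeneousComponent_of_mem hT₃,
      homogeneousComponent_of_mem hT₄]
    simp
  have hy (i : Fin 4) : ∃ q, y i ^ 3 = X i ^ 3 + C (3/2 : ℚ) * X i ^ 4 + X i ^ 5 * q := by
    refine ⟨C (5/4 : ℚ) +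
      C (3/4 : ℚ) * X i +
      C (1/3 : ℚ) * X i ^ 2 +
      C (11/96 : ℚ) * X i ^ 3 +
      C (53/1728 : ℚ) * X i ^ 4 +
      C (7/1152 : ℚ) * X i ^ 5 +
      C (1/1152 : ℚ) * X i ^ 6 +
      C (1/13824 : ℚ) * X i ^ 7, ?_⟩
    have hC (r : ℚ) : (C r : MvPolynomial (Fin 4) ℚ) = algebraMap ℚ _ r := rfl
    simp only [y, hC, ← Algebra.smul_def]
    algebra
  choose q hq using hy
  have h_pow : σ 1 ^ 3 - 3 * (σ 1 * σ 2) + 3 * σ 3 =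
      psum (Fin 4) ℚ 3 + C (3/2 : ℚ) * psum (Fin 4) ℚ 4 + ∑ i, X i ^ 5 * q i := by
    have h : σ 1 ^ 3 - 3 * (σ 1 * σ 2) + 3 * σ 3 = ∑ i, y i ^ 3 := by
      simp only [σ, Multiset.esymm_quadruple_one, Multiset.esymm_quadruple_two,
        Multiset.esymm_quadruple_three, Fin.sum_univ_four]
      ring
    simp only [h, hq, psum, Finset.sum_add_distrib, Finset.mul_sum]
  have h_tail : homogeneousComponent 4 ((∑ i, X i ^ 5 * q i) * Td₄) = 0 := by
    simp [Finset.sum_mul, mul_assoc, (isHomogeneous_X_pow _ 5).homogeneousComponent_mul]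
  rw [h_pow, add_mul, add_mul, map_add, map_add, h_tail,
    (isHomogeneous_psum 3).homogeneousComponent_mul,
    ((isHomogeneous_psum 4).C_mul _).homogeneousComponent_mul, if_pos (by simp), if_pos le_rfl,
    Nat.sub_self, hTd_zero, hTd_one]
  have hC : (C (3/2 : ℚ) : MvPolynomial (Fin 4) ℚ) = C (1/2 : ℚ) * 3 := by
    rw [← map_ofNat C 3, ← C_mul]
    norm_num
  simp only [e, esymm_fin_four_s10, Multiset.esymm_quadruple_one, Multiset.esymm_quadruple_two,
    Multiset.esymm_quadruple_three, Multiset.esymm_quadruple_four, psum, Fin.sum_univ_four, hC]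
  ring
end
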